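/- arXiv:2312.15214 — 4 statements merged into one kernel-verified Lean document; each statement's English description precedes it below -/
import Mathlib

section
/- Let n ≥ 1 and let Γ be a finite subgroup of the unitary group U(n) acting freely on S^{2n−1}. Then for all complex numbers z, w with |z| < 1 and |w| < 1, the double series Σ_{p,q ≥ 0} d_Γ(p,q)·z^p·w^q converges absolutely, and its sum equals (1/|Γ|) · Σ_{γ ∈ Γ} (1 − zw) / ( det(z·I − γ) · det(w·I − γ̄) ), where γ̄ denotes the entrywise complex conjugate of the matrix γ. -/
open MvPolynomial Matrix Complex

noncomputable section

/-- The polynomial ring `ℂ[z_1,…,z_n, z̄_1,…,z̄_n]`. -/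
abbrev Rn (n : ℕ) := MvPolynomial (Fin n ⊕ Fin n) ℂ

/-- Weight assigning `(1,0)` to each `z_j` and `(0,1)` to each `z̄_j`. -/
def wt (n : ℕ) : (Fin n ⊕ Fin n) → ℕ × ℕ := Sum.elim (fun _ => (1, 0)) (fun _ => (0, 1))

/-- `𝒫_{p,q}`: polynomials homogeneous of degree `p` in `z` and `q` in `z̄`. -/
def Ppq (n p q : ℕ) : Submodule ℂ (Rn n) :=
  MvPolynomial.weightedHomogeneousSubmodule ℂ (wt n) (p, q)

/-- `Δ = Σ_j ∂²/∂z_j∂z̄_j`. -/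
def DeltaOp (n : ℕ) : Rn n →ₗ[ℂ] Rn n :=
  ∑ j : Fin n, (MvPolynomial.pderiv (Sum.inl j)).toLinearMap ∘ₗ
    (MvPolynomial.pderiv (Sum.inr j)).toLinearMap

/-- `ℋ_{p,q}`: harmonic polynomials of bidegree `(p,q)`. -/
def Hpq (n p q : ℕ) : Submodule ℂ (Rn n) :=
  Ppq n p q ⊓ LinearMap.ker (DeltaOp n)

/-- The action of a matrix `γ` on `R_n` by the algebra substitution
`z_i ↦ Σ_j (γ⁻¹)_{ij} z_j`, `z̄_i ↦ Σ_j conj((γ⁻¹)_{ij}) z̄_j`. -/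
def matAct (n : ℕ) (γ : Matrix (Fin n) (Fin n) ℂ) : Rn n →ₐ[ℂ] Rn n :=
  MvPolynomial.aeval (Sum.elim
    (fun i => ∑ j, (γ⁻¹ i j) • MvPolynomial.X (Sum.inl j))
    (fun i => ∑ j, (starRingEnd ℂ) (γ⁻¹ i j) • MvPolynomial.X (Sum.inr j)))

/-- The subspace of polynomials fixed by the action of `γ`. -/
def fixedBy (n : ℕ) (γ : Matrix (Fin n) (Fin n) ℂ) : Submodule ℂ (Rn n) :=
  LinearMap.ker ((matAct n γ).toLinearMap - LinearMap.id)

/-- `ℋ_{p,q}^Γ`, the `Γ`-invariant harmonic polynomials of bidegree `(p,q)`. -/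
def HpqInv (n p q : ℕ) (Γ : Subgroup (Matrix.unitaryGroup (Fin n) ℂ)) : Submodule ℂ (Rn n) :=
  Hpq n p q ⊓ ⨅ γ ∈ Γ, fixedBy n ↑γ

/-- `d_Γ(p,q) = dim_ℂ ℋ_{p,q}^Γ`. -/
def dInv (n p q : ℕ) (Γ : Subgroup (Matrix.unitaryGroup (Fin n) ℂ)) : ℕ :=
  Module.finrank ℂ (HpqInv n p q Γ)

/-- A subgroup of `U(n)` acts freely on `S^{2n-1}` iff no nontrivial element has `1` as an
eigenvalue. -/
def actsFreely (n : ℕ) (Γ : Subgroup (Matrix.unitaryGroup (Fin n) ℂ)) : Prop :=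
  ∀ γ ∈ Γ, γ ≠ 1 → ∀ v : Fin n → ℂ, (↑γ : Matrix (Fin n) (Fin n) ℂ).mulVec v = v → v = 0

theorem hasSum_of_eq {ι : Type*} {f g : ι → ℂ} {a b : ℂ} (h : HasSum f a) (hfg : ∀ i, g i = f i)
    (hab : b = a) : HasSum g b := by
  rwa [hab, show g = f from funext hfg]

theorem hasSum_prod_geometric_fin (k : ℕ) (x : Fin k → ℂ) (hx : ∀ i, ‖x i‖ < 1) :
    HasSum (fun m : Fin k → ℕ => ∏ i, x i ^ m i) (∏ i, (1 - x i)⁻¹) := by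
  induction k with
  | zero => simp
  | succ k ih =>
    have h0 := hasSum_geometric_of_norm_lt_one (hx 0)
    have h1 : HasSum (fun m : Fin k → ℕ => ∏ i : Fin k, x i.succ ^ m i)
        (∏ i : Fin k, (1 - x i.succ)⁻¹) := ih (fun i => x i.succ) (fun i => hx _)
    have hn0 := h0.summable.norm
    have hn1 := h1.summable.norm
    have hs := summable_mul_of_summable_norm hn0 hn1
    have hm := HasSum.mul h0 h1 hs
    have hf : ((fun m : Fin (k + 1) → ℕ => ∏ i, x i ^ m i) ∘ Fin.consEquiv fun _ => ℕ)
        = fun y : ℕ × (Fin k → ℕ) => x 0 ^ y.1 * ∏ i : Fin k, x i.succ ^ y.2 i := by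
      funext y
      simp [Fin.consEquiv, Fin.prod_univ_succ]
    rw [← (Fin.consEquiv fun _ : Fin (k + 1) => ℕ).hasSum_iff, Fin.prod_univ_succ, hf]
    exact hm

theorem hasSum_prod_geometric {ι : Type*} [Fintype ι] (x : ι → ℂ) (hx : ∀ i, ‖x i‖ < 1) :
    HasSum (fun m : ι →₀ ℕ => ∏ i, x i ^ m i) (∏ i, (1 - x i)⁻¹) := by
  let e := Fintype.equivFin ι
  have h := hasSum_prod_geometric_fin _ (fun i => x (e.symm i)) (fun i => hx _)
  rw [e.symm.prod_comp (fun i => (1 - x i)⁻¹),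
    ← (Finsupp.equivFunOnFinite.trans (e.arrowCongr (Equiv.refl ℕ))).hasSum_iff] at h
  convert h using 2 with m
  simp [Equiv.arrowCongr, ← e.symm.prod_comp (fun i => x i ^ m i)]

/-- A complex matrix of finite order is diagonalizable with unimodular eigenvalues. -/
theorem exists_diagonalization_of_pow_eq_one {n : ℕ} (A : Matrix (Fin n) (Fin n) ℂ) {k : ℕ}
    (hk : k ≠ 0) (hA : A ^ k = 1) :
    ∃ (P Q : Matrix (Fin n) (Fin n) ℂ) (c : Fin n → ℂ),
      P * Q = 1 ∧ (∀ i, ‖c i‖ = 1) ∧ A = P * diagonal c * Q := by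
  have hAk : (toLin' A : Module.End ℂ (Fin n → ℂ)) ^ k = 1 := by
    rw [← toLin'_pow, hA, toLin'_one]; rfl
  have hss : Module.End.IsSemisimple (toLin' A) := by
    refine Module.End.isSemisimple_of_squarefree_aeval_eq_zero (p := Polynomial.X ^ k - 1) ?_ ?_
    · exact (Polynomial.X_pow_sub_one_separable_iff.2 (by exact_mod_cast hk)).squarefree
    · simp [hAk]
  have hspan : ⊤ ≤ Submodule.span ℂ
      {v : Fin n → ℂ | ∃ μ, Module.End.HasEigenvector (toLin' A) μ v} := by
    rw [← hss.iSup_eigenspace_eq_top]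
    refine iSup_le fun μ v hv => ?_
    by_cases h : v = 0
    · simp [h]
    · exact Submodule.subset_span ⟨μ, hv, h⟩
  let b₀ := Module.Basis.ofSpan hspan
  let b := b₀.reindex (b₀.indexEquiv (Pi.basisFun ℂ (Fin n)))
  have hb : ∀ i, ∃ μ, Module.End.HasEigenvector (toLin' A) μ (b i) := fun i => by
    apply Module.Basis.ofSpan_subset hspan
    simp [b, b₀]
  choose c hc using hb
  refine ⟨(Pi.basisFun ℂ (Fin n)).toMatrix b, b.toMatrix (Pi.basisFun ℂ (Fin n)), c,
    Module.Basis.toMatrix_mul_toMatrix_flip _ _, fun i => ?_, ?_⟩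
  · have h1 := (hc i).pow_apply k
    rw [hAk] at h1
    have h2 : c i ^ k = 1 := by
      have h3 : (c i ^ k - 1) • b i = 0 := by rw [sub_smul, ← h1]; simp
      rcases smul_eq_zero.1 h3 with h | h
      · exact sub_eq_zero.1 h
      · exact absurd h (hc i).2
    exact norm_eq_one_of_pow_eq_one h2 hk
  · have h1 : A * (Pi.basisFun ℂ (Fin n)).toMatrix b
        = (Pi.basisFun ℂ (Fin n)).toMatrix b * diagonal c := by
      ext i j
      have h := congrFun (hc j).apply_eq_smul i
      rw [toLin'_apply] at h
      rw [mul_diagonal]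
      simpa [mul_apply, Module.Basis.toMatrix_apply, mulVec, dotProduct, mul_comm] using h
    rw [← h1, Matrix.mul_assoc, Module.Basis.toMatrix_mul_toMatrix_flip, Matrix.mul_one]

/-- The algebra substitution `z ↦ A z`, `z̄ ↦ B z̄`. -/
def linSubst {n : ℕ} (A B : Matrix (Fin n) (Fin n) ℂ) : Rn n →ₐ[ℂ] Rn n :=
  MvPolynomial.aeval (Sum.elim
    (fun i => ∑ j, A i j • MvPolynomial.X (Sum.inl j))
    (fun i => ∑ j, B i j • MvPolynomial.X (Sum.inr j)))

section LinSubst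

variable {n : ℕ}

theorem matAct_eq_linSubst (γ : Matrix (Fin n) (Fin n) ℂ) :
    matAct n γ = linSubst γ⁻¹ (γ⁻¹.map (starRingEnd ℂ)) := rfl

@[simp]
theorem linSubst_X_inl (A B : Matrix (Fin n) (Fin n) ℂ) (i : Fin n) :
    linSubst A B (X (Sum.inl i)) = ∑ j, A i j • X (Sum.inl j) := by
  simp [linSubst]

@[simp]
theorem linSubst_X_inr (A B : Matrix (Fin n) (Fin n) ℂ) (i : Fin n) :
    linSubst A B (X (Sum.inr i)) = ∑ j, B i j • X (Sum.inr j) := by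
  simp [linSubst]

theorem linSubst_comp (A B A' B' : Matrix (Fin n) (Fin n) ℂ) :
    (linSubst A B).comp (linSubst A' B') = linSubst (A' * A) (B' * B) := by
  apply MvPolynomial.algHom_ext
  rintro (i | i)
  · simp only [AlgHom.comp_apply, linSubst_X_inl, map_sum, map_smul, mul_apply, Finset.smul_sum,
      Finset.sum_smul, smul_smul]
    exact Finset.sum_comm
  · simp only [AlgHom.comp_apply, linSubst_X_inr, map_sum, map_smul, mul_apply, Finset.smul_sum,
      Finset.sum_smul, smul_smul]
    exact Finset.sum_comm

theorem linSubst_one : linSubst (1 : Matrix (Fin n) (Fin n) ℂ) 1 = AlgHom.id ℂ (Rn n) := by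
  apply MvPolynomial.algHom_ext
  rintro (i | i) <;> simp [one_apply]

theorem linSubst_diagonal_monomial (a b : Fin n → ℂ) (m : Fin n ⊕ Fin n →₀ ℕ) (r : ℂ) :
    linSubst (diagonal a) (diagonal b) (monomial m r)
      = (∏ i, Sum.elim a b i ^ m i) • monomial m r := by
  have hX : ∀ i, linSubst (diagonal a) (diagonal b) (X i) = Sum.elim a b i • X i := by
    rintro (i | i) <;> simp [diagonal_apply]
  rw [monomial_eq, Finsupp.prod_fintype _ _ (by simp)]
  simp only [map_mul, map_prod, map_pow, hX, smul_pow, Finset.prod_smul]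
  rw [mul_smul_comm, ← MvPolynomial.algebraMap_eq, AlgHom.commutes]

theorem linSubst_mem_Ppq (A B : Matrix (Fin n) (Fin n) ℂ) {p q : ℕ} {f : Rn n}
    (hf : f ∈ Ppq n p q) : linSubst A B f ∈ Ppq n p q := by
  have hX : ∀ i, IsWeightedHomogeneous (wt n) (linSubst A B (X i)) (wt n i) := by
    rintro (i | i)
    · rw [linSubst_X_inl]
      refine IsWeightedHomogeneous.sum _ _ _ fun j _ => ?_
      rw [smul_eq_C_mul]
      exact (isWeightedHomogeneous_X ℂ (wt n) (Sum.inl j)).C_mul _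
    · rw [linSubst_X_inr]
      refine IsWeightedHomogeneous.sum _ _ _ fun j _ => ?_
      rw [smul_eq_C_mul]
      exact (isWeightedHomogeneous_X ℂ (wt n) (Sum.inr j)).C_mul _
  refine IsWeightedHomogeneous.induction_on
    (motive := fun f _ => linSubst A B f ∈ Ppq n p q) ?_ ?_ ?_ hf
  · simp
  · intro f g _ _ hf hg
    rw [map_add]
    exact add_mem hf hg
  · intro d r hd
    rw [monomial_eq, Finsupp.prod_fintype _ _ (by simp)]
    simp only [map_mul, map_prod, map_pow]
    rw [← MvPolynomial.algebraMap_eq, AlgHom.commutes, MvPolynomial.algebraMap_eq]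
    refine IsWeightedHomogeneous.C_mul ?_ _
    rw [← hd, Finsupp.weight_eq_sum]
    exact IsWeightedHomogeneous.prod _ _ _ fun i _ => (hX i).pow _

theorem pderiv_linSubst_inl (A B : Matrix (Fin n) (Fin n) ℂ) (j : Fin n) (f : Rn n) :
    pderiv (Sum.inl j) (linSubst A B f)
      = ∑ i, A i j • linSubst A B (pderiv (Sum.inl i) f) := by
  induction f using MvPolynomial.induction_on with
  | C a => simp [← MvPolynomial.algebraMap_eq]
  | add f g hf hg => simp [hf, hg, Finset.sum_add_distrib]
  | mul_X f i hf =>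
    have hX : pderiv (Sum.inl j) (linSubst A B (X i : Rn n))
        = ∑ k, A k j • linSubst A B (pderiv (Sum.inl k) (X i)) := by
      rcases i with i | i <;> simp [pderiv_X, Pi.single_apply, apply_ite, smul_eq_C_mul]
    simp only [map_mul, pderiv_mul, hf, hX, map_add, smul_add, Finset.sum_add_distrib,
      Finset.sum_mul, Finset.mul_sum, smul_mul_assoc, mul_smul_comm]

theorem pderiv_linSubst_inr (A B : Matrix (Fin n) (Fin n) ℂ) (j : Fin n) (f : Rn n) :
    pderiv (Sum.inr j) (linSubst A B f)
      = ∑ i, B i j • linSubst A B (pderiv (Sum.inr i) f) := by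
  induction f using MvPolynomial.induction_on with
  | C a => simp [← MvPolynomial.algebraMap_eq]
  | add f g hf hg => simp [hf, hg, Finset.sum_add_distrib]
  | mul_X f i hf =>
    have hX : pderiv (Sum.inr j) (linSubst A B (X i : Rn n))
        = ∑ k, B k j • linSubst A B (pderiv (Sum.inr k) (X i)) := by
      rcases i with i | i <;> simp [pderiv_X, Pi.single_apply, apply_ite, smul_eq_C_mul]
    simp only [map_mul, pderiv_mul, hf, hX, map_add, smul_add, Finset.sum_add_distrib,
      Finset.sum_mul, Finset.mul_sum, smul_mul_assoc, mul_smul_comm]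

theorem DeltaOp_apply (f : Rn n) :
    DeltaOp n f = ∑ j, pderiv (Sum.inl j) (pderiv (Sum.inr j) f) := by
  simp [DeltaOp]

theorem DeltaOp_linSubst {A B : Matrix (Fin n) (Fin n) ℂ} (h : A * Bᵀ = 1) (f : Rn n) :
    DeltaOp n (linSubst A B f) = linSubst A B (DeltaOp n f) := by
  have hAB : ∀ i k, ∑ j, B k j * A i j = if i = k then 1 else 0 := fun i k => by
    rw [← one_apply, ← h, mul_apply]
    simp [mul_comm]
  simp only [DeltaOp_apply, pderiv_linSubst_inl, pderiv_linSubst_inr, map_sum,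
    Derivation.map_smul, Finset.smul_sum, smul_smul]
  rw [Finset.sum_comm]
  refine Finset.sum_congr rfl fun k _ => ?_
  rw [Finset.sum_comm]
  simp only [← Finset.sum_smul, hAB]
  simp

end LinSubst

theorem isWeightedHomogeneous_pderiv {R σ M : Type*} [CommSemiring R] [AddCancelCommMonoid M]
    {w : σ → M} {i : σ} {d : M} {f : MvPolynomial σ R}
    (hf : IsWeightedHomogeneous w f (d + w i)) : IsWeightedHomogeneous w (pderiv i f) d := by
  refine IsWeightedHomogeneous.induction_on
    (motive := fun f _ => IsWeightedHomogeneous w (pderiv i f) d) ?_ ?_ ?_ hf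
  · simpa using isWeightedHomogeneous_zero R w d
  · intro f g _ _ hf hg
    rw [map_add]
    exact hf.add hg
  · intro m r hm
    rw [pderiv_monomial]
    by_cases h : m i = 0
    · simpa [h] using isWeightedHomogeneous_zero R w d
    · refine isWeightedHomogeneous_monomial _ _ _ ?_
      rw [← Finsupp.sub_add_single_one_cancel h, map_add, Finsupp.weight_single, one_smul] at hm
      exact add_right_cancel hm

section Ppq

variable {n : ℕ}

theorem monomial_mem_Ppq {p q : ℕ} {m : Fin n ⊕ Fin n →₀ ℕ} (r : ℂ)
    (hm : Finsupp.weight (wt n) m = (p, q)) : monomial m r ∈ Ppq n p q :=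
  isWeightedHomogeneous_monomial _ _ _ hm

theorem weight_wt (m : Fin n ⊕ Fin n →₀ ℕ) :
    Finsupp.weight (wt n) m = (∑ i, m (Sum.inl i), ∑ i, m (Sum.inr i)) := by
  simp [Finsupp.weight_eq_sum, wt, Prod.ext_iff, Prod.fst_sum, Prod.snd_sum]

instance finite_weight_wt (d : ℕ × ℕ) :
    Finite {m : Fin n ⊕ Fin n →₀ ℕ | Finsupp.weight (wt n) m = d} := by
  refine Set.Finite.subset (Finsupp.finite_of_nat_weight_eq (fun _ : Fin n ⊕ Fin n => 1)
    (by simp) (d.1 + d.2)) fun m hm => ?_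
  have hm' : Finsupp.weight (wt n) m = d := hm
  rw [weight_wt] at hm'
  simp [Finsupp.weight_eq_sum, ← hm']

theorem Ppq_eq_restrictSupport (p q : ℕ) :
    Ppq n p q = restrictSupport ℂ {m | Finsupp.weight (wt n) m = (p, q)} :=
  weightedHomogeneousSubmodule_eq_finsupp_supported _ _ _

/-- The monomial basis of `𝒫_{p,q}`. -/
def basisPpq (n p q : ℕ) :
    Module.Basis {m : Fin n ⊕ Fin n →₀ ℕ | Finsupp.weight (wt n) m = (p, q)} ℂ (Ppq n p q) :=
  (basisRestrictSupport ℂ _).map (LinearEquiv.ofEq _ _ (Ppq_eq_restrictSupport p q).symm)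

theorem basisPpq_repr_apply (p q : ℕ) (f : Ppq n p q)
    (m : {m : Fin n ⊕ Fin n →₀ ℕ | Finsupp.weight (wt n) m = (p, q)}) :
    (basisPpq n p q).repr f m = coeff m (f : Rn n) := rfl

theorem basisPpq_apply (p q : ℕ)
    (m : {m : Fin n ⊕ Fin n →₀ ℕ | Finsupp.weight (wt n) m = (p, q)}) :
    (basisPpq n p q m : Rn n) = monomial m 1 := by
  have h : basisPpq n p q m = ⟨monomial (m : Fin n ⊕ Fin n →₀ ℕ) 1, monomial_mem_Ppq 1 m.2⟩ := by
    rw [Module.Basis.apply_eq_iff]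
    ext m'
    rw [basisPpq_repr_apply, coeff_monomial, Finsupp.single_apply]
    simp [Subtype.ext_iff]
  rw [h]

instance finite_Ppq (p q : ℕ) : Module.Finite ℂ (Ppq n p q) :=
  Module.Finite.of_basis (basisPpq n p q)

theorem pderiv_pderiv_mem_Ppq {p q : ℕ} (j : Fin n) {f : Rn n} (hf : f ∈ Ppq n (p + 1) (q + 1)) :
    pderiv (Sum.inl j) (pderiv (Sum.inr j) f) ∈ Ppq n p q :=
  isWeightedHomogeneous_pderiv (i := Sum.inl j) (d := (p, q)) <|
    isWeightedHomogeneous_pderiv (i := Sum.inr j) (d := (p + 1, q)) hf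

theorem DeltaOp_mem_Ppq {p q : ℕ} {f : Rn n} (hf : f ∈ Ppq n (p + 1) (q + 1)) :
    DeltaOp n f ∈ Ppq n p q := by
  rw [DeltaOp_apply]
  exact sum_mem fun j _ => pderiv_pderiv_mem_Ppq j hf

theorem DeltaOp_eq_zero_of_mem_Ppq {p q : ℕ} (hpq : p = 0 ∨ q = 0) {f : Rn n}
    (hf : f ∈ Ppq n p q) : DeltaOp n f = 0 := by
  refine IsWeightedHomogeneous.induction_on (motive := fun f _ => DeltaOp n f = 0)
    (map_zero _) (fun f g _ _ hf hg => by rw [map_add, hf, hg, add_zero]) (fun m r hm => ?_) hf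
  rw [weight_wt, Prod.mk.injEq] at hm
  rw [DeltaOp_apply]
  refine Finset.sum_eq_zero fun j _ => ?_
  have h0 : m (Sum.inl j) = 0 ∨ m (Sum.inr j) = 0 := by
    rcases hpq with h | h
    · exact .inl (Finset.sum_eq_zero_iff.1 (hm.1.trans h) j (Finset.mem_univ j))
    · exact .inr (Finset.sum_eq_zero_iff.1 (hm.2.trans h) j (Finset.mem_univ j))
  rcases h0 with h0 | h0 <;> simp [pderiv_monomial, h0]

theorem monomial_mem_map_DeltaOp (j₀ : Fin n) {p q : ℕ} (m : Fin n ⊕ Fin n →₀ ℕ)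
    (hm : Finsupp.weight (wt n) m = (p, q)) :
    monomial m 1 ∈ (Ppq n (p + 1) (q + 1)).map (DeltaOp n) := by
  induction hk : ∑ i ∈ Finset.univ.erase j₀, m (Sum.inl i) using Nat.strong_induction_on
    generalizing m with
  | _ k ih =>
  set s : Fin n ⊕ Fin n →₀ ℕ :=
    m + Finsupp.single (Sum.inl j₀) 1 + Finsupp.single (Sum.inr j₀) 1 with hs
  have hsw : Finsupp.weight (wt n) s = (p + 1, q + 1) := by
    rw [hs, map_add, map_add, hm]
    simp [wt, Finsupp.weight_single]
  have hterm : ∀ j, pderiv (Sum.inl j) (pderiv (Sum.inr j) (monomial s (1 : ℂ)))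
      = monomial (s - Finsupp.single (Sum.inr j) 1 - Finsupp.single (Sum.inl j) 1)
        ((s (Sum.inr j) : ℂ) * s (Sum.inl j)) := fun j => by
    simp [pderiv_monomial]
  have hrest : ∀ j ∈ Finset.univ.erase j₀,
      pderiv (Sum.inl j) (pderiv (Sum.inr j) (monomial s (1 : ℂ)))
        ∈ (Ppq n (p + 1) (q + 1)).map (DeltaOp n) := fun j hj => by
    have hj0 : j ≠ j₀ := Finset.ne_of_mem_erase hj
    by_cases h0 : m (Sum.inl j) = 0 ∨ m (Sum.inr j) = 0
    · have : (s (Sum.inr j) : ℂ) * s (Sum.inl j) = 0 := by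
        rcases h0 with h0 | h0 <;> simp [hs, h0, hj0]
      rw [hterm, this, monomial_zero]
      exact zero_mem _
    push Not at h0
    set t := s - Finsupp.single (Sum.inr j) 1 - Finsupp.single (Sum.inl j) 1 with ht
    have hts : t + Finsupp.single (Sum.inl j) 1 + Finsupp.single (Sum.inr j) 1 = s := by
      ext i
      rcases i with i | i <;> by_cases h : j = i <;>
        simp [ht, hs, h, Finsupp.single_apply] <;> grind
    have htw : Finsupp.weight (wt n) t = (p, q) := by
      have h := hsw
      rw [← hts] at h
      simpa [wt, Finsupp.weight_single, Prod.ext_iff] using h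
    have hmem := ih _ ?_ t htw rfl
    · rw [hterm, ← mul_one ((s (Sum.inr j) : ℂ) * s (Sum.inl j)), ← smul_eq_mul,
        ← MvPolynomial.smul_monomial]
      exact Submodule.smul_mem _ _ hmem
    · rw [← hk]
      refine Finset.sum_lt_sum (fun i hi => ?_) ⟨j, hj, ?_⟩
      · have := Finset.ne_of_mem_erase hi
        simp [ht, hs, Finsupp.single_apply, this.symm]
      · simp [ht, hs, hj0.symm]
        omega
  have hsum : DeltaOp n (monomial s 1)
      = pderiv (Sum.inl j₀) (pderiv (Sum.inr j₀) (monomial s (1 : ℂ)))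
        + ∑ j ∈ Finset.univ.erase j₀,
          pderiv (Sum.inl j) (pderiv (Sum.inr j) (monomial s (1 : ℂ))) := by
    rw [DeltaOp_apply, ← Finset.add_sum_erase _ _ (Finset.mem_univ j₀)]
  have hmain : pderiv (Sum.inl j₀) (pderiv (Sum.inr j₀) (monomial s (1 : ℂ)))
      ∈ (Ppq n (p + 1) (q + 1)).map (DeltaOp n) := by
    rw [← sub_eq_of_eq_add hsum]
    exact sub_mem (Submodule.mem_map_of_mem (monomial_mem_Ppq 1 hsw)) (sum_mem hrest)
  have hc : ((s (Sum.inr j₀) : ℂ) * s (Sum.inl j₀)) ≠ 0 := by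
    rw [← Nat.cast_mul, Nat.cast_ne_zero]
    simp [hs]
  have hsm : s - Finsupp.single (Sum.inr j₀) 1 - Finsupp.single (Sum.inl j₀) 1 = m := by
    ext i
    simp [hs]
  rw [hterm, hsm] at hmain
  have h := Submodule.smul_mem _ ((s (Sum.inr j₀) : ℂ) * s (Sum.inl j₀))⁻¹ hmain
  rwa [MvPolynomial.smul_monomial, smul_eq_mul, inv_mul_cancel₀ hc] at h

theorem Ppq_le_map_DeltaOp (hn : 1 ≤ n) (p q : ℕ) :
    Ppq n p q ≤ (Ppq n (p + 1) (q + 1)).map (DeltaOp n) := by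
  rw [Ppq_eq_restrictSupport p q, restrictSupport_eq_span, Submodule.span_le]
  rintro _ ⟨m, hm, rfl⟩
  exact monomial_mem_map_DeltaOp ⟨0, hn⟩ m hm

end Ppq

section Trace

variable {n : ℕ}

/-- The action of `linSubst A B` on `𝒫_{p,q}`. -/
def linSubstPpq (p q : ℕ) (A B : Matrix (Fin n) (Fin n) ℂ) : Module.End ℂ (Ppq n p q) :=
  (linSubst A B).toLinearMap.restrict fun _ hf => linSubst_mem_Ppq A B hf

@[simp]
theorem coe_linSubstPpq_apply (p q : ℕ) (A B : Matrix (Fin n) (Fin n) ℂ) (f : Ppq n p q) :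
    (linSubstPpq p q A B f : Rn n) = linSubst A B f := rfl

theorem linSubstPpq_mul (p q : ℕ) (A B A' B' : Matrix (Fin n) (Fin n) ℂ) :
    linSubstPpq p q A B * linSubstPpq p q A' B' = linSubstPpq p q (A' * A) (B' * B) := by
  ext1 f
  apply Subtype.ext
  simp [← linSubst_comp]

theorem linSubstPpq_one (p q : ℕ) :
    linSubstPpq p q (1 : Matrix (Fin n) (Fin n) ℂ) 1 = 1 := by
  ext1 f
  apply Subtype.ext
  simp [linSubst_one]

theorem trace_linSubstPpq_diagonal (p q : ℕ) (a b : Fin n → ℂ)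
    [Fintype {m : Fin n ⊕ Fin n →₀ ℕ | Finsupp.weight (wt n) m = (p, q)}] :
    LinearMap.trace ℂ _ (linSubstPpq p q (diagonal a) (diagonal b))
      = ∑ m : {m : Fin n ⊕ Fin n →₀ ℕ | Finsupp.weight (wt n) m = (p, q)},
        ∏ i, Sum.elim a b i ^ (m : Fin n ⊕ Fin n →₀ ℕ) i := by
  classical
  rw [LinearMap.trace_eq_matrix_trace ℂ (basisPpq n p q), Matrix.trace]
  refine Finset.sum_congr rfl fun m _ => ?_
  rw [Matrix.diag_apply, LinearMap.toMatrix_apply, basisPpq_repr_apply, coe_linSubstPpq_apply,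
    basisPpq_apply, linSubst_diagonal_monomial]
  simp

theorem trace_linSubstPpq_conj (p q : ℕ) {P Q P' Q' : Matrix (Fin n) (Fin n) ℂ}
    (h : P * Q = 1) (h' : P' * Q' = 1) (A B : Matrix (Fin n) (Fin n) ℂ) :
    LinearMap.trace ℂ _ (linSubstPpq p q (P * A * Q) (P' * B * Q'))
      = LinearMap.trace ℂ _ (linSubstPpq p q A B) := by
  rw [← linSubstPpq_mul, ← linSubstPpq_mul, LinearMap.trace_mul_comm, mul_assoc, linSubstPpq_mul,
    mul_eq_one_comm.1 h, mul_eq_one_comm.1 h', linSubstPpq_one, mul_one]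

theorem hasSum_trace_linSubstPpq_diagonal (a b : Fin n → ℂ) (ha : ∀ i, ‖a i‖ = 1)
    (hb : ∀ i, ‖b i‖ = 1) {z w : ℂ} (hz : ‖z‖ < 1) (hw : ‖w‖ < 1) :
    HasSum (fun pq : ℕ × ℕ =>
        LinearMap.trace ℂ _ (linSubstPpq pq.1 pq.2 (diagonal a) (diagonal b)) * z ^ pq.1 * w ^ pq.2)
      ((∏ i, (1 - a i * z)⁻¹) * ∏ i, (1 - b i * w)⁻¹) := by
  let x : Fin n ⊕ Fin n → ℂ := Sum.elim (fun i => a i * z) (fun i => b i * w)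
  have hx : ∀ i, ‖x i‖ < 1 := by
    rintro (i | i) <;> simp [x, ha, hb, hz, hw]
  have h := hasSum_prod_geometric x hx
  rw [← (Equiv.sigmaFiberEquiv (Finsupp.weight (wt n))).hasSum_iff] at h
  have hprod : ∏ i, (1 - x i)⁻¹ = (∏ i, (1 - a i * z)⁻¹) * ∏ i, (1 - b i * w)⁻¹ := by
    simp [x, Fintype.prod_sum_type, mul_comm]
  rw [hprod] at h
  refine h.sigma fun pq => ?_
  obtain ⟨p, q⟩ := pq
  have := Fintype.ofFinite {m : Fin n ⊕ Fin n →₀ ℕ | Finsupp.weight (wt n) m = (p, q)}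
  have key : LinearMap.trace ℂ _ (linSubstPpq p q (diagonal a) (diagonal b)) * z ^ p * w ^ q
      = ∑ m : {m : Fin n ⊕ Fin n →₀ ℕ | Finsupp.weight (wt n) m = (p, q)},
        ∏ i, x i ^ (m : Fin n ⊕ Fin n →₀ ℕ) i := by
    rw [trace_linSubstPpq_diagonal, Finset.sum_mul, Finset.sum_mul]
    refine Finset.sum_congr rfl fun m _ => ?_
    have hm : Finsupp.weight (wt n) (m : Fin n ⊕ Fin n →₀ ℕ) = (p, q) := m.2
    rw [weight_wt, Prod.mk.injEq] at hm
    simp only [Fintype.prod_sum_type, x, Sum.elim_inl, Sum.elim_inr, mul_pow,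
      Finset.prod_mul_distrib, Finset.prod_pow_eq_pow_sum, hm.1, hm.2]
    ring
  simp only
  rw [key]
  exact hasSum_fintype
    (fun m : {m : Fin n ⊕ Fin n →₀ ℕ | Finsupp.weight (wt n) m = (p, q)} =>
      ∏ i, x i ^ (m : Fin n ⊕ Fin n →₀ ℕ) i)

theorem hasSum_trace_matAct {γ : Matrix (Fin n) (Fin n) ℂ} {k : ℕ} (hk : k ≠ 0)
    (hγ : γ ^ k = 1) {z w : ℂ} (hz : ‖z‖ < 1) (hw : ‖w‖ < 1) :
    HasSum (fun pq : ℕ × ℕ =>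
        LinearMap.trace ℂ _ (linSubstPpq pq.1 pq.2 γ⁻¹ (γ⁻¹.map (starRingEnd ℂ)))
          * z ^ pq.1 * w ^ pq.2)
      (Matrix.det (z • (1 : Matrix (Fin n) (Fin n) ℂ) - γ) *
        Matrix.det (w • (1 : Matrix (Fin n) (Fin n) ℂ) - γ.map (starRingEnd ℂ)))⁻¹ := by
  obtain ⟨P, Q, c, hPQ, hc, rfl⟩ := exists_diagonalization_of_pow_eq_one γ hk hγ
  have hQP : Q * P = 1 := mul_eq_one_comm.1 hPQ
  have hcc : ∀ i, c i * starRingEnd ℂ (c i) = 1 := fun i => by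
    rw [mul_conj, normSq_eq_norm_sq, hc]
    simp
  set cb : Fin n → ℂ := fun i => starRingEnd ℂ (c i) with hcb
  have hinv : (P * diagonal c * Q)⁻¹ = P * diagonal cb * Q := by
    refine Matrix.inv_eq_right_inv ?_
    calc P * diagonal c * Q * (P * diagonal cb * Q)
        = P * diagonal c * (Q * P) * diagonal cb * Q := by simp only [Matrix.mul_assoc]
      _ = 1 := by
        rw [hQP, Matrix.mul_one, Matrix.mul_assoc P, diagonal_mul_diagonal]
        simp [hcb, hcc, hPQ]
  have hmap : ∀ d : Fin n → ℂ, (P * diagonal d * Q).map (starRingEnd ℂ)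
      = P.map (starRingEnd ℂ) * diagonal (fun i => starRingEnd ℂ (d i)) *
        Q.map (starRingEnd ℂ) := fun d => by
    rw [Matrix.map_mul, Matrix.map_mul, diagonal_map (map_zero _)]
  have hPQ' : P.map (starRingEnd ℂ) * Q.map (starRingEnd ℂ) = 1 := by
    rw [← Matrix.map_mul, hPQ, Matrix.map_one _ (map_zero _) (map_one _)]
  have hdet : ∀ {P Q : Matrix (Fin n) (Fin n) ℂ}, P * Q = 1 → ∀ (d : Fin n → ℂ) (z : ℂ),
      Matrix.det (z • (1 : Matrix (Fin n) (Fin n) ℂ) - P * diagonal d * Q)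
        = ∏ i, (z - d i) := fun {P Q} hPQ d z => by
    have h : z • (1 : Matrix (Fin n) (Fin n) ℂ) - P * diagonal d * Q
        = P * diagonal (fun i => z - d i) * Q := by
      have hd : diagonal (fun i => z - d i) = z • (1 : Matrix (Fin n) (Fin n) ℂ) - diagonal d := by
        rw [smul_one_eq_diagonal, diagonal_sub]
      rw [hd, Matrix.mul_sub, Matrix.sub_mul]
      simp [hPQ]
    rw [h, det_conj_of_mul_eq_one hPQ (mul_eq_one_comm.1 hPQ), det_diagonal]
  simp only [hinv, hmap, trace_linSubstPpq_conj _ _ hPQ hPQ']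
  rw [hdet hPQ, hdet hPQ']
  convert hasSum_trace_linSubstPpq_diagonal cb (fun i => starRingEnd ℂ (cb i))
    (by simp [hcb, hc]) (by simp [hcb, hc]) hz hw using 1
  rw [← Finset.prod_mul_distrib, ← Finset.prod_mul_distrib, ← Finset.prod_inv_distrib]
  refine Finset.prod_congr rfl fun i _ => ?_
  rw [← mul_inv]
  congr 1
  have h := hcc i
  simp only [hcb, Complex.conj_conj]
  linear_combination (1 - z * w) * h

end Trace

section Invariants

variable {n : ℕ}

/-- The representation of `Γ` on `𝒫_{p,q}`. -/
def repPpq (p q : ℕ) (Γ : Subgroup (Matrix.unitaryGroup (Fin n) ℂ)) :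
    Representation ℂ Γ (Ppq n p q) where
  toFun γ := linSubstPpq p q (γ : Matrix (Fin n) (Fin n) ℂ)⁻¹
    ((γ : Matrix (Fin n) (Fin n) ℂ)⁻¹.map (starRingEnd ℂ))
  map_one' := by
    simpa [Matrix.map_one _ (map_zero (starRingEnd ℂ)) (map_one _)] using linSubstPpq_one p q
  map_mul' γ δ := by
    rw [linSubstPpq_mul, ← Matrix.map_mul, ← Matrix.mul_inv_rev]
    rfl

theorem coe_repPpq_apply (p q : ℕ) (Γ : Subgroup (Matrix.unitaryGroup (Fin n) ℂ)) (γ : Γ)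
    (f : Ppq n p q) :
    (repPpq p q Γ γ f : Rn n) = matAct n (γ : Matrix (Fin n) (Fin n) ℂ) f := rfl

theorem DeltaOp_matAct (γ : Matrix.unitaryGroup (Fin n) ℂ) (f : Rn n) :
    DeltaOp n (matAct n γ f) = matAct n γ (DeltaOp n f) := by
  rw [matAct_eq_linSubst]
  refine DeltaOp_linSubst ?_ f
  have hinv : (γ : Matrix (Fin n) (Fin n) ℂ)⁻¹ = star (γ : Matrix (Fin n) (Fin n) ℂ) :=
    Matrix.inv_eq_right_inv (Matrix.mem_unitaryGroup_iff.1 γ.2)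
  have h2 : ((star (γ : Matrix (Fin n) (Fin n) ℂ)).map (starRingEnd ℂ))ᵀ
      = (γ : Matrix (Fin n) (Fin n) ℂ) := by
    ext i j
    simp
  rw [hinv, h2]
  exact Matrix.mem_unitaryGroup_iff'.1 γ.2

theorem mem_HpqInv {p q : ℕ} {Γ : Subgroup (Matrix.unitaryGroup (Fin n) ℂ)} {f : Rn n} :
    f ∈ HpqInv n p q Γ ↔
      f ∈ Ppq n p q ∧ DeltaOp n f = 0 ∧ ∀ γ : Γ, matAct n (γ : Matrix (Fin n) (Fin n) ℂ) f = f := by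
  simp [HpqInv, Hpq, fixedBy, Submodule.mem_iInf, sub_eq_zero, and_assoc]

/-- `Δ` as a map `𝒫_{p+1,q+1} → 𝒫_{p,q}`. -/
def DeltaPpq (n p q : ℕ) : Ppq n (p + 1) (q + 1) →ₗ[ℂ] Ppq n p q :=
  (DeltaOp n).restrict fun _ hf => DeltaOp_mem_Ppq hf

theorem DeltaPpq_repPpq (p q : ℕ) (Γ : Subgroup (Matrix.unitaryGroup (Fin n) ℂ)) (γ : Γ)
    (f : Ppq n (p + 1) (q + 1)) :
    DeltaPpq n p q (repPpq (p + 1) (q + 1) Γ γ f) = repPpq p q Γ γ (DeltaPpq n p q f) :=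
  Subtype.ext (DeltaOp_matAct γ.1 f)

theorem DeltaPpq_surjective (hn : 1 ≤ n) (p q : ℕ) : Function.Surjective (DeltaPpq n p q) := by
  rintro ⟨g, hg⟩
  obtain ⟨f, hf, rfl⟩ := Ppq_le_map_DeltaOp hn p q hg
  exact ⟨⟨f, hf⟩, rfl⟩

/-- A surjective equivariant map of representations of a finite group is surjective on
invariants. -/
theorem exists_mem_invariants_map_eq {k G V W : Type*} [CommRing k] [Group G] [AddCommGroup V]
    [Module k V] [AddCommGroup W] [Module k W] [Fintype G] [Invertible (Fintype.card G : k)]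
    (ρ : Representation k G V) (σ : Representation k G W) (T : V →ₗ[k] W)
    (hT : ∀ g v, T (ρ g v) = σ g (T v)) (hs : Function.Surjective T) {y : W}
    (hy : y ∈ σ.invariants) : ∃ x ∈ ρ.invariants, T x = y := by
  obtain ⟨v, rfl⟩ := hs y
  refine ⟨ρ.averageMap v, ρ.averageMap_invariant v, ?_⟩
  rw [← σ.averageMap_id _ hy]
  simp [GroupAlgebra.average, map_sum, hT]

theorem dInv_eq_finrank_invariants {p q : ℕ} (hpq : p = 0 ∨ q = 0)
    (Γ : Subgroup (Matrix.unitaryGroup (Fin n) ℂ)) :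
    dInv n p q Γ = Module.finrank ℂ (repPpq p q Γ).invariants := by
  have h : HpqInv n p q Γ = (repPpq p q Γ).invariants.map (Ppq n p q).subtype := by
    ext f
    simp only [mem_HpqInv, Submodule.mem_map, Representation.mem_invariants, Subtype.ext_iff,
      coe_repPpq_apply]
    constructor
    · rintro ⟨h1, -, h3⟩
      exact ⟨⟨f, h1⟩, h3, rfl⟩
    · rintro ⟨f, h, rfl⟩
      exact ⟨f.2, DeltaOp_eq_zero_of_mem_Ppq hpq f.2, h⟩
  rw [dInv, h]
  exact (Submodule.equivMapOfInjective _ (Submodule.injective_subtype _) _).finrank_eq.symm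

theorem finrank_inf_ker_add_finrank_map {K V W : Type*} [Field K] [AddCommGroup V] [Module K V]
    [AddCommGroup W] [Module K W] [Module.Finite K V] (T : V →ₗ[K] W) (A : Submodule K V) :
    Module.finrank K ↥(A ⊓ LinearMap.ker T) + Module.finrank K (A.map T)
      = Module.finrank K A := by
  have h := LinearMap.finrank_range_add_finrank_ker (T.domRestrict A)
  rw [LinearMap.range_domRestrict, LinearMap.ker_domRestrict] at h
  rw [← h, add_comm, ← Submodule.map_comap_subtype]
  congr 1
  exact (Submodule.equivMapOfInjective _ A.injective_subtype _).finrank_eq.symm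

theorem dInv_add_finrank_invariants (hn : 1 ≤ n) (p q : ℕ)
    (Γ : Subgroup (Matrix.unitaryGroup (Fin n) ℂ)) [Fintype Γ] :
    dInv n (p + 1) (q + 1) Γ + Module.finrank ℂ (repPpq p q Γ).invariants
      = Module.finrank ℂ (repPpq (p + 1) (q + 1) Γ).invariants := by
  have : Invertible (Fintype.card Γ : ℂ) := invertibleOfNonzero (by simp)
  have hmap : (repPpq (p + 1) (q + 1) Γ).invariants.map (DeltaPpq n p q)
      = (repPpq p q Γ).invariants := by
    refine le_antisymm ?_ fun g hg => ?_
    · rintro _ ⟨f, hf, rfl⟩ γ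
      rw [← DeltaPpq_repPpq, hf γ]
    · exact exists_mem_invariants_map_eq (repPpq (p + 1) (q + 1) Γ) (repPpq p q Γ)
        (DeltaPpq n p q) (DeltaPpq_repPpq p q Γ) (DeltaPpq_surjective hn p q) hg
  have hker : HpqInv n (p + 1) (q + 1) Γ = ((repPpq (p + 1) (q + 1) Γ).invariants ⊓
      LinearMap.ker (DeltaPpq n p q)).map (Ppq n (p + 1) (q + 1)).subtype := by
    ext f
    rw [mem_HpqInv, Submodule.mem_map]
    constructor
    · rintro ⟨h1, h2, h3⟩
      exact ⟨⟨f, h1⟩, ⟨fun γ => Subtype.ext (h3 γ), Subtype.ext h2⟩, rfl⟩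
    · rintro ⟨⟨f, h1⟩, ⟨h3, h2⟩, rfl⟩
      exact ⟨h1, congrArg Subtype.val h2, fun γ => congrArg Subtype.val (h3 γ)⟩
  have h := finrank_inf_ker_add_finrank_map (DeltaPpq n p q) (repPpq (p + 1) (q + 1) Γ).invariants
  rw [hmap] at h
  rw [dInv, hker, ← h]
  congr 1
  exact (Submodule.equivMapOfInjective _ (Submodule.injective_subtype _) _).finrank_eq.symm

end Invariants

theorem hasSum_finrank_invariants {n : ℕ} (Γ : Subgroup (Matrix.unitaryGroup (Fin n) ℂ))
    [Fintype Γ] {z w : ℂ} (hz : ‖z‖ < 1) (hw : ‖w‖ < 1) :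
    HasSum (fun pq : ℕ × ℕ =>
        (Module.finrank ℂ (repPpq pq.1 pq.2 Γ).invariants : ℂ) * z ^ pq.1 * w ^ pq.2)
      ((Nat.card Γ : ℂ)⁻¹ * ∑ γ : Γ,
        (Matrix.det (z • (1 : Matrix (Fin n) (Fin n) ℂ) - (↑↑γ : Matrix (Fin n) (Fin n) ℂ)) *
         Matrix.det (w • (1 : Matrix (Fin n) (Fin n) ℂ) -
           ((↑↑γ : Matrix (Fin n) (Fin n) ℂ)).map (starRingEnd ℂ)))⁻¹) := by
  have : Invertible (Nat.card Γ : ℂ) := invertibleOfNonzero (by simp)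
  have hpow : ∀ γ : Γ, (γ : Matrix (Fin n) (Fin n) ℂ) ^ Fintype.card Γ = 1 := fun γ => by
    have h : γ ^ Fintype.card Γ = 1 := pow_card_eq_one
    exact congrArg (fun δ : Γ => (δ : Matrix (Fin n) (Fin n) ℂ)) h
  have h := (hasSum_sum (s := Finset.univ) fun (γ : Γ) _ =>
    hasSum_trace_matAct Fintype.card_ne_zero (hpow γ) hz hw).mul_left (Nat.card Γ : ℂ)⁻¹
  refine hasSum_of_eq h (fun pq => ?_) rfl
  rw [← Representation.card_inv_mul_sum_char_eq_finrank, ← Finset.sum_mul, ← Finset.sum_mul,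
    mul_assoc, mul_assoc, mul_assoc]
  rfl

theorem hasSum_dInv {n : ℕ} (hn : 1 ≤ n) (Γ : Subgroup (Matrix.unitaryGroup (Fin n) ℂ))
    [Fintype Γ] {z w S : ℂ}
    (h : HasSum (fun pq : ℕ × ℕ =>
      (Module.finrank ℂ (repPpq pq.1 pq.2 Γ).invariants : ℂ) * z ^ pq.1 * w ^ pq.2) S) :
    HasSum (fun pq : ℕ × ℕ => (dInv n pq.1 pq.2 Γ : ℂ) * z ^ pq.1 * w ^ pq.2)
      ((1 - z * w) * S) := by
  let e : ℕ × ℕ → ℂ := fun pq =>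
    (Module.finrank ℂ (repPpq pq.1 pq.2 Γ).invariants : ℂ) * z ^ pq.1 * w ^ pq.2
  let d : ℕ × ℕ → ℂ := fun pq => (dInv n pq.1 pq.2 Γ : ℂ) * z ^ pq.1 * w ^ pq.2
  have hinj : Function.Injective (Prod.map Nat.succ Nat.succ) :=
    Nat.succ_injective.prodMap Nat.succ_injective
  have hshift : HasSum (fun pq => e pq - d pq) (z * w * S) := by
    rw [← hinj.hasSum_iff]
    · refine hasSum_of_eq (h.mul_left (z * w)) (fun ⟨p, q⟩ => ?_) rfl
      have hd := dInv_add_finrank_invariants hn p q Γ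
      simp only [e, d, Function.comp_apply, Prod.map_apply, Nat.succ_eq_add_one, ← hd]
      push_cast
      ring
    · rintro ⟨p, q⟩ hpq
      have h0 : p = 0 ∨ q = 0 := by
        rcases p with _ | p
        · exact Or.inl rfl
        · rcases q with _ | q
          · exact Or.inr rfl
          · exact absurd ⟨(p, q), rfl⟩ hpq
      simp only [e, d, dInv_eq_finrank_invariants h0, sub_self]
  exact hasSum_of_eq (h.sub hshift) (fun pq => (sub_sub_cancel (e pq) (d pq)).symm) (by ring)

/-- **Theorem (rational expression for the generating function).**
For a finite subgroup `Γ ≤ U(n)` acting freely on `S^{2n-1}` and `|z|, |w| < 1`, the double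
series `Σ_{p,q} dim ℋ_{p,q}^Γ z^p w^q` converges absolutely and equals
`(1/|Γ|) Σ_{γ ∈ Γ} (1 - zw) / (det(zI - γ) det(wI - γ̄))`. -/
theorem generating_function_rational_expression
    (n : ℕ) (hn : 1 ≤ n) (Γ : Subgroup (Matrix.unitaryGroup (Fin n) ℂ)) [Fintype Γ]
    (hfree : actsFreely n Γ) (z w : ℂ) (hz : ‖z‖ < 1) (hw : ‖w‖ < 1) :
    Summable (fun pq : ℕ × ℕ => ‖(dInv n pq.1 pq.2 Γ : ℂ) * z ^ pq.1 * w ^ pq.2‖) ∧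
    HasSum (fun pq : ℕ × ℕ => (dInv n pq.1 pq.2 Γ : ℂ) * z ^ pq.1 * w ^ pq.2)
      ((Nat.card Γ : ℂ)⁻¹ * ∑ γ : Γ,
        (1 - z * w) /
          (Matrix.det (z • (1 : Matrix (Fin n) (Fin n) ℂ) - (↑↑γ : Matrix (Fin n) (Fin n) ℂ)) *
           Matrix.det (w • (1 : Matrix (Fin n) (Fin n) ℂ) -
             ((↑↑γ : Matrix (Fin n) (Fin n) ℂ)).map (starRingEnd ℂ)))) := by
  have h := hasSum_dInv hn Γ (hasSum_finrank_invariants Γ hz hw)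
  rw [mul_left_comm, Finset.mul_sum] at h
  simp only [← div_eq_mul_inv] at h
  exact ⟨h.summable.norm, h⟩

end
end

section
/- Let k be an odd prime with k ≥ 5 and set n = k − 3. Consider the set 𝒮(n,k) of tuples s : {1,…,n} → ℤ/kℤ such that every s_i is a unit, the s_i are pairwise distinct, and there exists i such that s_i ≠ −s_j for all j. Define s ≈ s' if there exist a permutation σ of {1,…,n} and a unit c of ℤ/kℤ with s_i = c·s'_{σ(i)} for all i. Then the quotient 𝒮(n,k)/≈ is finite and has exactly (k−3)/2 elements. -/
/-- The parameter set `𝒮(n,k)` of the family `𝒢(n,k)`: tuples of pairwise distinct units of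
`ℤ/kℤ` such that some `s_i` is not the negative of any `s_j`. -/
def ScalSet (n k : ℕ) : Set (Fin n → ZMod k) :=
  {s | (∀ i, IsUnit (s i)) ∧ Function.Injective s ∧ ∃ i, ∀ j, s i ≠ - s j}

/-- The relation `s ≈ s'`: there are a permutation `σ` and a unit `c` with
`s_i = c·s'_{σ(i)}` for all `i` (equivalence of the CR lens spaces `L(k;s)`, `L(k;s')`). -/
def lensRel (n k : ℕ) (s s' : Fin n → ZMod k) : Prop :=
  ∃ σ : Equiv.Perm (Fin n), ∃ c : (ZMod k)ˣ, ∀ i, s i = (c : ZMod k) * s' (σ i)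

/-- `lensRel` as an equivalence relation (setoid) on `𝒮(n,k)`. -/
def lensSetoid (n k : ℕ) : Setoid (ScalSet n k) where
  r a b := lensRel n k a.1 b.1
  iseqv := by
    constructor
    · intro a
      exact ⟨Equiv.refl _, 1, fun i => by simp⟩
    · rintro a b ⟨σ, c, h⟩
      refine ⟨σ.symm, c⁻¹, fun i => ?_⟩
      have := h (σ.symm i)
      rw [Equiv.apply_symm_apply] at this
      rw [this]
      rw [← mul_assoc, ← Units.val_mul, inv_mul_cancel, Units.val_one, one_mul]
    · rintro a b cc ⟨σ, c, h⟩ ⟨τ, d, h'⟩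
      refine ⟨σ.trans τ, c * d, fun i => ?_⟩
      rw [h i, h' (σ i), Units.val_mul, mul_assoc]
      rfl

/-- Two pairs of nonzero elements with the same value of `a / b + b / a` differ by a scalar. -/
theorem exists_pair_eq_smul_of_div_add_div_eq {K : Type*} [Field K] {a b a' b' : K}
    (ha : a ≠ 0) (hb : b ≠ 0) (ha' : a' ≠ 0) (hb' : b' ≠ 0)
    (h : a / b + b / a = a' / b' + b' / a') :
    ∃ c : Kˣ, (a = c * a' ∧ b = c * b') ∨ (a = c * b' ∧ b = c * a') := by
  have key : (a * b' - a' * b) * (a * a' - b * b') = 0 := by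
    field_simp at h
    linear_combination h
  rcases mul_eq_zero.mp key with h1 | h1
  · refine ⟨Units.mk0 (a / a') (div_ne_zero ha ha'), Or.inl ⟨?_, ?_⟩⟩
    · simp [ha']
    · simp only [Units.val_mk0]
      field_simp
      linear_combination -h1
  · refine ⟨Units.mk0 (a / b') (div_ne_zero ha hb'), Or.inr ⟨?_, ?_⟩⟩
    · simp [hb']
    · simp only [Units.val_mk0]
      field_simp
      linear_combination -h1

/-- The map `r ↦ r + r⁻¹` is two-to-one on the elements of a finite field
different from `0, 1, -1`. -/
theorem two_mul_card_image_add_inv {K : Type*} [Field K] [Fintype K] [DecidableEq K] :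
    2 * ((Finset.univ \ {0, 1, -1} : Finset K).image fun r => r + r⁻¹).card =
      (Finset.univ \ {0, 1, -1} : Finset K).card := by
  rw [Finset.card_eq_sum_card_image (fun r : K => r + r⁻¹) (Finset.univ \ {0, 1, -1}),
    Finset.sum_const_nat (m := 2), mul_comm]
  intro y hy
  obtain ⟨r, hr, rfl⟩ := Finset.mem_image.mp hy
  simp only [Finset.mem_sdiff, Finset.mem_univ, true_and, Finset.mem_insert,
    Finset.mem_singleton, not_or] at hr
  obtain ⟨h0, h1, h2⟩ := hr
  have hne : r ≠ r⁻¹ := by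
    intro h
    have : (r - 1) * (r + 1) = 0 := by
      have h' : r * r = 1 := by
        nth_rewrite 2 [h]
        exact mul_inv_cancel₀ h0
      linear_combination h'
    rcases mul_eq_zero.mp this with h' | h'
    · exact h1 (sub_eq_zero.mp h')
    · exact h2 (eq_neg_of_add_eq_zero_left h')
  rw [← Finset.card_pair hne]
  congr 1
  ext x
  simp only [Finset.mem_filter, Finset.mem_sdiff, Finset.mem_univ, true_and, Finset.mem_insert,
    Finset.mem_singleton, not_or]
  constructor
  · rintro ⟨⟨hx, -, -⟩, h⟩
    have : (x - r) * (x * r - 1) = 0 := by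
      field_simp at h
      linear_combination h
    rcases mul_eq_zero.mp this with h' | h'
    · exact Or.inl (sub_eq_zero.mp h')
    · exact Or.inr (eq_inv_of_mul_eq_one_left (sub_eq_zero.mp h'))
  · rintro (rfl | rfl)
    · exact ⟨⟨h0, h1, h2⟩, rfl⟩
    · refine ⟨⟨inv_ne_zero h0, ?_, ?_⟩, ?_⟩
      · simpa using h1
      · rw [inv_eq_iff_eq_inv, inv_neg, inv_one]
        exact h2
      · rw [inv_inv, add_comm]

/-- `IsMissingPair s a b` says that the entries of `s` are exactly the nonzero elements
other than `a` and `b`, where `a, b` are nonzero and `a ≠ ±b`. -/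
structure IsMissingPair {n k : ℕ} (s : Fin n → ZMod k) (a b : ZMod k) : Prop where
  left_ne_zero : a ≠ 0
  right_ne_zero : b ≠ 0
  ne : a ≠ b
  ne_neg : a ≠ -b
  exists_iff : ∀ x, (∃ i, s i = x) ↔ x ≠ 0 ∧ x ≠ a ∧ x ≠ b

theorem exists_isMissingPair {k : ℕ} [Fact k.Prime] (hk3 : 3 ≤ k)
    {s : Fin (k - 3) → ZMod k} (hs : s ∈ ScalSet (k - 3) k) :
    ∃ a b, IsMissingPair s a b := by
  obtain ⟨hu, hinj, i, hi⟩ := hs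
  have h0 : (0 : ZMod k) ∉ Finset.univ.image s := by
    simp only [Finset.mem_image, Finset.mem_univ, true_and, not_exists]
    exact fun j => (hu j).ne_zero
  have hcard : ((insert 0 (Finset.univ.image s))ᶜ : Finset (ZMod k)).card = 2 := by
    rw [Finset.card_compl, Finset.card_insert_of_notMem h0, Finset.card_image_of_injective _ hinj,
      Finset.card_univ, Fintype.card_fin, ZMod.card]
    omega
  obtain ⟨a, b, hab, hC⟩ := Finset.card_eq_two.mp hcard
  have hmem : ∀ x, (x ≠ 0 ∧ ¬ ∃ j, s j = x) ↔ x = a ∨ x = b := by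
    intro x
    have := congrArg (x ∈ ·) hC
    simpa using this
  have ha := (hmem a).mpr (Or.inl rfl)
  have hb := (hmem b).mpr (Or.inr rfl)
  refine ⟨a, b, ha.1, hb.1, hab, ?_, ?_⟩
  · rintro rfl
    have h := (hmem (-s i)).mp
      ⟨neg_ne_zero.mpr (hu i).ne_zero, fun ⟨j, hj⟩ => hi j (by rw [hj, neg_neg])⟩
    rcases h with h | h
    · exact hb.2 ⟨i, neg_injective h⟩
    · exact ha.2 ⟨i, by rw [← h, neg_neg]⟩
  · intro x
    constructor
    · rintro ⟨j, rfl⟩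
      refine ⟨(hu j).ne_zero, ?_, ?_⟩ <;> rintro rfl
      · exact ha.2 ⟨j, rfl⟩
      · exact hb.2 ⟨j, rfl⟩
    · rintro ⟨hx, hxa, hxb⟩
      by_contra h
      exact ((hmem x).mp ⟨hx, h⟩).elim hxa hxb

theorem exists_scalSet_isMissingPair {k : ℕ} [Fact k.Prime] {a b : ZMod k}
    (ha : a ≠ 0) (hb : b ≠ 0) (hab : a ≠ b) (hab' : a ≠ -b) (h2 : (2 : ZMod k) ≠ 0) :
    ∃ s ∈ ScalSet (k - 3) k, IsMissingPair s a b := by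
  have hcard : ({0, a, b}ᶜ : Finset (ZMod k)).card = k - 3 := by
    rw [Finset.card_compl, ZMod.card, Finset.card_eq_three.mpr ⟨0, a, b, ha.symm, hb.symm, hab, rfl⟩]
  let e := Finset.equivFinOfCardEq hcard
  have hex : ∀ x, (∃ i, (e.symm i : ZMod k) = x) ↔ x ≠ 0 ∧ x ≠ a ∧ x ≠ b := by
    intro x
    constructor
    · rintro ⟨i, rfl⟩
      simpa using (e.symm i).2
    · intro hx
      exact ⟨e ⟨x, by simpa using hx⟩, by simp⟩
  refine ⟨fun i => e.symm i, ⟨fun i => ?_, ?_, ?_⟩, ha, hb, hab, hab', hex⟩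
  · exact isUnit_iff_ne_zero.mpr ((hex _).mp ⟨i, rfl⟩).1
  · exact Subtype.val_injective.comp e.symm.injective
  · have hna : -a ≠ a := by
      intro h
      have h' : 2 * a = 0 := by linear_combination -h
      exact (mul_ne_zero h2 ha) h'
    obtain ⟨i, hi⟩ := (hex (-a)).mpr
      ⟨neg_ne_zero.mpr ha, hna, fun h => hab' (by rw [← h, neg_neg])⟩
    refine ⟨i, fun j hj => ((hex _).mp ⟨j, rfl⟩).2.1 ?_⟩
    exact neg_injective (hj.symm.trans hi)

theorem IsMissingPair.div_add_div_eq {n k : ℕ} [Fact k.Prime] {s s' : Fin n → ZMod k}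
    {a b a' b' : ZMod k} (h : IsMissingPair s a b) (h' : IsMissingPair s' a' b')
    (hr : lensRel n k s s') : a / b + b / a = a' / b' + b' / a' := by
  obtain ⟨σ, c, hc⟩ := hr
  have hc0 : (c : ZMod k) ≠ 0 := c.ne_zero
  have hmem : ∀ x : ZMod k, c * x ≠ 0 → c * x = a ∨ c * x = b → x = a' ∨ x = b' := by
    intro x hx hxab
    by_contra hcon
    rw [not_or] at hcon
    obtain ⟨j, rfl⟩ := (h'.exists_iff x).mpr ⟨right_ne_zero_of_mul hx, hcon⟩
    have := (h.exists_iff (c * s' j)).mp ⟨σ.symm j, by simp [hc]⟩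
    exact hxab.elim this.2.1 this.2.2
  have hca : c * ((c : ZMod k)⁻¹ * a) = a := mul_inv_cancel_left₀ hc0 a
  have hcb : c * ((c : ZMod k)⁻¹ * b) = b := mul_inv_cancel_left₀ hc0 b
  have hA := hmem _ (by rw [hca]; exact h.left_ne_zero) (Or.inl hca)
  have hB := hmem _ (by rw [hcb]; exact h.right_ne_zero) (Or.inr hcb)
  have ha' := h'.left_ne_zero
  have hb' := h'.right_ne_zero
  rw [← hca, ← hcb, mul_div_mul_left _ _ hc0, mul_div_mul_left _ _ hc0]
  rcases hA with hA | hA <;> rcases hB with hB | hB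
  · exact (h.ne (by rw [← hca, ← hcb, hA, hB])).elim
  · rw [hA, hB]
  · rw [hA, hB, add_comm]
  · exact (h.ne (by rw [← hca, ← hcb, hA, hB])).elim

theorem lensRel_of_exists_iff {n k : ℕ} {s s' : Fin n → ZMod k} (hs : Function.Injective s)
    (c : (ZMod k)ˣ) (h : ∀ i, ∃ j, s' j = (↑c⁻¹ : ZMod k) * s i) : lensRel n k s s' := by
  choose f hf using h
  have hinj : Function.Injective f := by
    intro i j hij
    apply hs
    have : (↑c⁻¹ : ZMod k) * s i = ↑c⁻¹ * s j := by rw [← hf, ← hf, hij]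
    exact c⁻¹.isUnit.mul_left_cancel this
  refine ⟨Equiv.ofBijective f (Finite.injective_iff_bijective.mp hinj), c, fun i => ?_⟩
  rw [Equiv.ofBijective_apply, hf, Units.mul_inv_cancel_left]

theorem IsMissingPair.lensRel {n k : ℕ} [Fact k.Prime] {s s' : Fin n → ZMod k}
    {a b a' b' : ZMod k} (h : IsMissingPair s a b) (h' : IsMissingPair s' a' b')
    (hs : Function.Injective s) (heq : a / b + b / a = a' / b' + b' / a') :
    lensRel n k s s' := by
  obtain ⟨c, hc⟩ := exists_pair_eq_smul_of_div_add_div_eq h.left_ne_zero h.right_ne_zero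
    h'.left_ne_zero h'.right_ne_zero heq
  refine lensRel_of_exists_iff hs c fun i => (h'.exists_iff _).mpr ?_
  obtain ⟨h0, ha, hb⟩ := (h.exists_iff _).mp ⟨i, rfl⟩
  refine ⟨mul_ne_zero c⁻¹.ne_zero h0, ?_, ?_⟩ <;>
    rw [Ne, Units.inv_mul_eq_iff_eq_mul] <;> rcases hc with ⟨h1, h2⟩ | ⟨h1, h2⟩
  · rwa [← h1]
  · rwa [← h2]
  · rwa [← h2]
  · rwa [← h1]

/-- **Counting the equivalence classes in `𝒢(k-3,k)`.**
For an odd prime `k ≥ 5` and `n = k-3`, the quotient `𝒮(n,k)/≈` is finite with exactly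
`(k-3)/2` elements. -/
theorem card_G_family_classes (k : ℕ) (hk : Nat.Prime k) (hodd : Odd k) (hk5 : 5 ≤ k) :
    Finite (Quotient (lensSetoid (k - 3) k)) ∧
      Nat.card (Quotient (lensSetoid (k - 3) k)) = (k - 3) / 2 := by
  have : Fact k.Prime := ⟨hk⟩
  have h2 : (2 : ZMod k) ≠ 0 := by
    intro h
    have := Nat.le_of_dvd two_pos ((ZMod.natCast_eq_zero_iff 2 k).mp (by exact_mod_cast h))
    omega
  have h1 : (1 : ZMod k) ≠ -1 := fun h => h2 (by linear_combination h)
  choose a b hab using fun s : ScalSet (k - 3) k => exists_isMissingPair (by omega) s.2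
  let F : Quotient (lensSetoid (k - 3) k) → ZMod k :=
    Quotient.lift (fun s => a s / b s + b s / a s)
      fun s s' h => (hab s).div_add_div_eq (hab s') h
  have hF : Function.Injective F := by
    rintro ⟨s⟩ ⟨s'⟩ h
    exact Quotient.sound ((hab s).lensRel (hab s') s.2.2.1 h)
  have hrange : Set.range F =
      ((Finset.univ \ {0, 1, -1} : Finset (ZMod k)).image fun r => r + r⁻¹ : Finset (ZMod k)) := by
    ext y
    simp only [Set.mem_range, Finset.coe_image, Set.mem_image, Finset.mem_coe, Finset.mem_sdiff,
      Finset.mem_univ, true_and, Finset.mem_insert, Finset.mem_singleton, not_or]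
    constructor
    · rintro ⟨⟨s⟩, rfl⟩
      have h := hab s
      refine ⟨a s / b s, ⟨div_ne_zero h.left_ne_zero h.right_ne_zero, ?_, ?_⟩, ?_⟩
      · rw [div_eq_one_iff_eq h.right_ne_zero]
        exact h.ne
      · rw [div_eq_iff h.right_ne_zero, neg_one_mul]
        exact h.ne_neg
      · rw [inv_div]
    · rintro ⟨r, ⟨hr0, hr1, hr2⟩, rfl⟩
      obtain ⟨s, hs, h⟩ := exists_scalSet_isMissingPair hr0 one_ne_zero hr1 hr2 h2
      refine ⟨Quotient.mk _ ⟨s, hs⟩, ?_⟩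
      have := (hab ⟨s, hs⟩).div_add_div_eq h ((lensSetoid (k - 3) k).refl ⟨s, hs⟩)
      rwa [div_one, one_div] at this
  refine ⟨Finite.of_injective F hF, ?_⟩
  rw [Nat.card_congr (Equiv.ofInjective F hF), hrange, Nat.card_coe_set_eq, Set.ncard_coe_finset]
  have hcard := two_mul_card_image_add_inv (K := ZMod k)
  rw [← Finset.compl_eq_univ_sdiff, Finset.card_compl, ZMod.card, Finset.card_eq_three.mpr
    ⟨0, 1, -1, zero_ne_one, (neg_ne_zero.mpr one_ne_zero).symm, h1, rfl⟩] at hcard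
  rw [← Finset.compl_eq_univ_sdiff]
  omega
end

section
/- Let n ≥ 3 and let r > 3 be an odd integer; set k = r² and θ = r + 1, and let ξ = exp(2πi/k). Let 0 ≤ a_1 < a_2 < … < a_n < r be integers with gcd(a_i − a_j, r) = 1 for all i ≠ j. Then for all complex numbers z, w with z^k ≠ 1 and w^k ≠ 1: Σ_{m=0}^{k−1} Π_{j=1}^{n} [ (z − ξ^{m·θ^{a_j}})·(w − ξ^{−m·θ^{a_j}}) ]^{−1} = Σ_{m=0}^{k−1} Π_{j=1}^{n} [ (z − ξ^{m·θ^{r−a_j}})·(w − ξ^{−m·θ^{r−a_j}}) ]^{−1}. (Here θ^{r−a_j} represents θ^{−a_j} modulo k, since θ^r ≡ 1 (mod r²).) -/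
open Complex

noncomputable section

/-- The standard primitive `k`-th root of unity `ξ_k = exp(2πi/k)`. -/
def xi (k : ℕ) : ℂ := Complex.exp (2 * Real.pi * Complex.I / k)

/-- A product over signs with total `0` is unchanged under negating all signs. -/
theorem prod_sign_neg_eq {ι : Type*} [Fintype ι] (k : SignType → ℂ) (e : ι → SignType)
    (he : ∑ i, (e i : ℤ) = 0) : ∏ i, k (-e i) = ∏ i, k (e i) := by
  have hk : ∀ s : SignType, k s = k 0 ^ (if s = 0 then 1 else 0) *
      k 1 ^ (if s = 1 then 1 else 0) * k (-1) ^ (if s = -1 then 1 else 0) := by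
    intro s
    cases s <;> simp [SignType.zero_eq_zero, SignType.neg_eq_neg_one, SignType.pos_eq_one]
  have hcount : ∑ i, (if e i = 1 then 1 else 0) = ∑ i, (if e i = -1 then 1 else 0) := by
    zify
    rw [← sub_eq_zero, ← Finset.sum_sub_distrib]
    refine (Finset.sum_congr rfl fun i _ => ?_).trans he
    cases e i <;> simp [SignType.zero_eq_zero, SignType.neg_eq_neg_one, SignType.pos_eq_one]
  have hneg : ∀ s : SignType, k (-s) = k 0 ^ (if s = 0 then 1 else 0) *
      k 1 ^ (if s = -1 then 1 else 0) * k (-1) ^ (if s = 1 then 1 else 0) := by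
    intro s
    cases s <;> simp [SignType.zero_eq_zero, SignType.neg_eq_neg_one, SignType.pos_eq_one]
  rw [Finset.prod_congr rfl fun i _ => hneg (e i), Finset.prod_congr rfl fun i _ => hk (e i)]
  simp only [Finset.prod_mul_distrib, Finset.prod_pow_eq_pow_sum, hcount]

/-- An additive character turns finite sums into finite products. -/
theorem addChar_map_sum {A M ι : Type*} [AddCommMonoid A] [CommMonoid M] (φ : AddChar A M)
    (s : Finset ι) (f : ι → A) : φ (∑ i ∈ s, f i) = ∏ i ∈ s, φ (f i) := by
  classical
  induction s using Finset.induction_on with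
  | empty => simp
  | insert i s hi ih => rw [Finset.sum_insert hi, Finset.prod_insert hi, φ.map_add_eq_mul, ih]

/-- Expansion of a sum over all translates of a product of trinomials in an additive character. -/
theorem sum_prod_trinomial_eq {r : ℕ} [NeZero r] {φ : AddChar (ZMod r) ℂ} (hφ : φ.IsPrimitive)
    {ι : Type*} [Fintype ι] [DecidableEq ι] (c : ι → ZMod r) (k : SignType → ℂ) :
    ∑ t, ∏ i, ∑ s : SignType, k s * φ (((s : ℤ) : ZMod r) * (t + c i)) =
      ∑ e : ι → SignType, (∏ i, k (e i)) * φ (∑ i, ((e i : ℤ) : ZMod r) * c i) *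
        (if ((∑ i, (e i : ℤ) : ℤ) : ZMod r) = 0 then (r : ℂ) else 0) := by
  simp_rw [Finset.prod_univ_sum, Fintype.piFinset_univ]
  rw [Finset.sum_comm]
  refine Finset.sum_congr rfl fun e _ => ?_
  have h := AddChar.sum_mulShift ((∑ i, (e i : ℤ) : ℤ) : ZMod r) hφ
  rw [ZMod.card] at h
  push_cast at h ⊢
  rw [← h, Finset.mul_sum]
  refine Finset.sum_congr rfl fun t _ => ?_
  rw [Finset.prod_mul_distrib, mul_assoc, ← AddChar.map_add_eq_mul, Finset.mul_sum,
    ← Finset.sum_add_distrib, addChar_map_sum]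
  congr 1
  refine Finset.prod_congr rfl fun i _ => ?_
  exact congrArg φ (by ring)

/-- Short products of trinomials have the same average for `c` and for `-c`. -/
theorem sum_prod_trinomial_neg {r : ℕ} [NeZero r] {φ : AddChar (ZMod r) ℂ} (hφ : φ.IsPrimitive)
    {ι : Type*} [Fintype ι] (hι : Fintype.card ι < r) (c : ι → ZMod r) (k : SignType → ℂ) :
    ∑ t, ∏ i, ∑ s : SignType, k s * φ (((s : ℤ) : ZMod r) * (t + c i)) =
      ∑ t, ∏ i, ∑ s : SignType, k s * φ (((s : ℤ) : ZMod r) * (t - c i)) := by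
  classical
  simp_rw [sub_eq_add_neg]
  rw [sum_prod_trinomial_eq hφ c, sum_prod_trinomial_eq hφ fun i => -c i]
  refine Fintype.sum_equiv (Equiv.neg _) _ _ fun e => ?_
  have hcast : ∀ s : SignType, ((-s : SignType) : ℤ) = -(s : ℤ) := by decide
  simp only [Equiv.neg_apply, Pi.neg_apply, hcast, Finset.sum_neg_distrib, Int.cast_neg,
    neg_mul_neg, neg_eq_zero]
  split_ifs with h
  · have hbound : |∑ i, (e i : ℤ)| ≤ Fintype.card ι := by
      refine (Finset.abs_sum_le_sum_abs _ _).trans ?_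
      have : ∀ s : SignType, |(s : ℤ)| ≤ 1 := by decide
      simpa using Finset.sum_le_sum fun i (_ : i ∈ Finset.univ) => this (e i)
    have h0 : ∑ i, (e i : ℤ) = 0 := by
      refine Int.eq_zero_of_abs_lt_dvd ((ZMod.intCast_zmod_eq_zero_iff_dvd _ _).1 h) ?_
      exact hbound.trans_lt (mod_cast hι)
    rw [prod_sign_neg_eq k e h0]
  · simp

/-- The product of the two linear factors attached to the point `v`. -/
def pairFactor (z w v : ℂ) : ℂ := (z - v) * (w - v⁻¹)

/-- On a coset of the `r`-th roots of unity, `pairFactor` is a trinomial in the character. -/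
theorem pairFactor_eq_sum {r : ℕ} (φ : AddChar (ZMod r) ℂ) (z w : ℂ) {u : ℂ} (hu : u ≠ 0)
    (x : ZMod r) :
    pairFactor z w (u * φ x) = ∑ s : SignType,
      (if s = 0 then z * w + 1 else if s = 1 then -(w * u) else -(z * u⁻¹)) *
        φ (((s : ℤ) : ZMod r) * x) := by
  have h1 : φ x ≠ 0 := (φ.val_isUnit x).ne_zero
  have huniv : (Finset.univ : Finset SignType) = {0, -1, 1} := rfl
  rw [huniv, Finset.sum_insert (by decide), Finset.sum_insert (by decide), Finset.sum_singleton]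
  simp [pairFactor, AddChar.map_neg_eq_inv]
  field_simp
  ring

/-- The sum of the reciprocal products over a coset of the `r`-th roots of unity is invariant under
negating the shifts. -/
theorem sum_inv_prod_pairFactor_neg {r : ℕ} [NeZero r] {φ : AddChar (ZMod r) ℂ}
    (hφ : φ.IsPrimitive) {ι : Type*} [Fintype ι] [Nonempty ι] {b : ι → ZMod r}
    (hb : Function.Injective b) {z w u : ℂ} (hu : u ≠ 0)
    (hne : ∀ x, pairFactor z w (u * φ x) ≠ 0) :
    ∑ t, (∏ i, pairFactor z w (u * φ (t + b i)))⁻¹ =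
      ∑ t, (∏ i, pairFactor z w (u * φ (t - b i)))⁻¹ := by
  classical
  set D := ∏ x, pairFactor z w (u * φ x) with hD
  set S : Finset (ZMod r) := Finset.univ.image b with hS
  have key : ∀ σ : ZMod r ≃ ZMod r, (∏ i, pairFactor z w (u * φ (σ (b i))))⁻¹ =
      D⁻¹ * ∏ c : (Sᶜ : Finset (ZMod r)), pairFactor z w (u * φ (σ c)) := by
    intro σ
    have h1 : ∏ i, pairFactor z w (u * φ (σ (b i))) = ∏ c ∈ S, pairFactor z w (u * φ (σ c)) := by
      rw [hS, Finset.prod_image hb.injOn]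
    have h2 : D = (∏ c ∈ S, pairFactor z w (u * φ (σ c))) *
        ∏ c ∈ Sᶜ, pairFactor z w (u * φ (σ c)) := by
      rw [Finset.prod_mul_prod_compl, hD, Equiv.prod_comp σ fun x => pairFactor z w (u * φ x)]
    have h3 : ∏ c ∈ S, pairFactor z w (u * φ (σ c)) ≠ 0 :=
      Finset.prod_ne_zero_iff.2 fun c _ => hne _
    have h4 : ∏ c ∈ Sᶜ, pairFactor z w (u * φ (σ c)) ≠ 0 :=
      Finset.prod_ne_zero_iff.2 fun c _ => hne _
    rw [h1, h2, Finset.prod_coe_sort Sᶜ fun c => pairFactor z w (u * φ (σ c))]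
    field_simp
  have hcard : Fintype.card (Sᶜ : Finset (ZMod r)) < r := by
    have hpos : 0 < S.card := by
      rw [hS, Finset.card_pos]
      exact Finset.univ_nonempty.image b
    rw [Fintype.card_coe, Finset.card_compl, ZMod.card]
    exact Nat.sub_lt (NeZero.pos r) hpos
  have hplus := fun t => key (Equiv.addLeft t)
  have hminus := fun t => key (Equiv.subLeft t)
  simp only [Equiv.coe_addLeft, Equiv.subLeft_apply] at hplus hminus
  simp_rw [hplus, hminus, ← Finset.mul_sum, pairFactor_eq_sum φ z w hu]
  rw [sum_prod_trinomial_neg hφ hcard]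

/-- A sum over `range (r * q)` splits according to the residue modulo `r`. -/
theorem sum_range_mul_eq {M : Type*} [AddCommMonoid M] (f : ℕ → M) (r q : ℕ) :
    ∑ m ∈ Finset.range (r * q), f m =
      ∑ m ∈ Finset.range r, ∑ t ∈ Finset.range q, f (m + r * t) := by
  rw [Finset.sum_comm]
  induction q with
  | zero => simp
  | succ q ih =>
    rw [Nat.mul_succ, Finset.sum_range_add, ih, Finset.sum_range_succ]
    simp only [add_comm]

/-- Summation over `range r` of a function of the residue class. -/
theorem sum_range_natCast_zmod {M : Type*} [AddCommMonoid M] (r : ℕ) [NeZero r] (f : ZMod r → M) :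
    ∑ t ∈ Finset.range r, f (t : ZMod r) = ∑ t, f t := by
  refine Finset.sum_nbij' (fun t => (t : ZMod r)) ZMod.val (by simp) ?_ ?_ (by simp) (by simp)
  · intro t _
    exact Finset.mem_range.2 (ZMod.val_lt t)
  · intro t ht
    exact ZMod.val_cast_of_lt (Finset.mem_range.1 ht)

theorem xi_ne_zero (k : ℕ) : xi k ≠ 0 := Complex.exp_ne_zero _

theorem xi_pow_self (k : ℕ) [NeZero k] : xi k ^ k = 1 := by
  have hk : (k : ℂ) ≠ 0 := Nat.cast_ne_zero.2 (NeZero.ne k)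
  rw [xi, ← Complex.exp_nat_mul, mul_div_cancel₀ _ hk, Complex.exp_two_pi_mul_I]

theorem xi_sq_zpow_mul (r : ℕ) [NeZero r] (e : ℤ) :
    xi (r ^ 2) ^ ((r : ℤ) * e) = ZMod.stdAddChar (e : ZMod r) := by
  have hr : (r : ℂ) ≠ 0 := Nat.cast_ne_zero.2 (NeZero.ne r)
  rw [ZMod.stdAddChar_coe, xi, ← Complex.exp_int_mul]
  congr 1
  push_cast
  field_simp

/-- Powers of `1 + r` are linear modulo `r ^ 2`. -/
theorem sq_dvd_succ_pow_sub (r a : ℕ) :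
    ((r : ℤ) ^ 2) ∣ ((r : ℤ) + 1) ^ a - (1 + a * r) := by
  induction a with
  | zero => simp
  | succ a ih =>
    obtain ⟨d, hd⟩ := ih
    refine ⟨d * (r + 1) + a, ?_⟩
    rw [pow_succ, eq_add_of_sub_eq hd]
    push_cast
    ring

theorem xi_sq_zpow_mul_succ_pow (r m t a : ℕ) [NeZero r] :
    xi (r ^ 2) ^ (((m + r * t : ℕ) : ℤ) * ((r : ℤ) + 1) ^ a) =
      xi (r ^ 2) ^ m * ZMod.stdAddChar ((t : ZMod r) + (a : ZMod r) * (m : ZMod r)) := by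
  obtain ⟨d, hd⟩ := sq_dvd_succ_pow_sub r a
  have hcast : ((t : ZMod r) + (a : ZMod r) * (m : ZMod r)) =
      ((t + a * m + r * (t * a + (m + r * t) * d) : ℤ) : ZMod r) := by
    push_cast
    simp
  rw [hcast, ← xi_sq_zpow_mul, ← zpow_natCast, ← zpow_add₀ (xi_ne_zero _),
    eq_add_of_sub_eq hd]
  congr 1
  push_cast
  ring

/-- **The key rational-function identity behind the DeFord–Doyle type family.**
For `n ≥ 3`, odd `r > 3`, `k = r²`, `θ = r+1`, and `0 ≤ a_1 < … < a_n < r` with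
`gcd(a_i - a_j, r) = 1` for `i ≠ j`: for all `z, w` with `z^k ≠ 1 ≠ w^k`,
`Σ_{m=0}^{k-1} Π_j [(z - ξ^{mθ^{a_j}})(w - ξ^{-mθ^{a_j}})]⁻¹`
equals the same sum with exponents `θ^{r - a_j}` in place of `θ^{a_j}`. -/
theorem deford_doyle_identity (n r : ℕ) (hn : 3 ≤ n) (hr : 3 < r) (hodd : Odd r)
    (a : Fin n → ℕ) (hmono : StrictMono a) (har : ∀ i, a i < r)
    (hgcd : ∀ i j, i ≠ j → Int.gcd ((a i : ℤ) - (a j : ℤ)) r = 1)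
    (z w : ℂ) (hz : z ^ (r ^ 2) ≠ 1) (hw : w ^ (r ^ 2) ≠ 1) :
    ∑ m ∈ Finset.range (r ^ 2),
      (∏ j, ((z - xi (r ^ 2) ^ ((m : ℤ) * ((r : ℤ) + 1) ^ (a j))) *
        (w - xi (r ^ 2) ^ (-(m : ℤ) * ((r : ℤ) + 1) ^ (a j)))))⁻¹
    = ∑ m ∈ Finset.range (r ^ 2),
      (∏ j, ((z - xi (r ^ 2) ^ ((m : ℤ) * ((r : ℤ) + 1) ^ (r - a j))) *
        (w - xi (r ^ 2) ^ (-(m : ℤ) * ((r : ℤ) + 1) ^ (r - a j)))))⁻¹ := by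
  have : NeZero r := ⟨by omega⟩
  have : Nonempty (Fin n) := ⟨⟨0, by omega⟩⟩
  have hterm : ∀ m t c : ℕ,
      (z - xi (r ^ 2) ^ (((m + r * t : ℕ) : ℤ) * ((r : ℤ) + 1) ^ c)) *
        (w - xi (r ^ 2) ^ (-((m + r * t : ℕ) : ℤ) * ((r : ℤ) + 1) ^ c)) =
      pairFactor z w (xi (r ^ 2) ^ m *
        ZMod.stdAddChar ((t : ZMod r) + (c : ZMod r) * (m : ZMod r))) := by
    intro m t c
    rw [pairFactor, ← xi_sq_zpow_mul_succ_pow, neg_mul, zpow_neg]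
  rw [pow_two r, sum_range_mul_eq, sum_range_mul_eq, ← pow_two]
  refine Finset.sum_congr rfl fun m hm => ?_
  simp_rw [hterm]
  rw [sum_range_natCast_zmod r fun t => (∏ j, pairFactor z w (xi (r ^ 2) ^ m *
      ZMod.stdAddChar (t + (a j : ZMod r) * (m : ZMod r))))⁻¹,
    sum_range_natCast_zmod r fun t => (∏ j, pairFactor z w (xi (r ^ 2) ^ m *
      ZMod.stdAddChar (t + ((r - a j : ℕ) : ZMod r) * (m : ZMod r))))⁻¹]
  have hsub : ∀ j, (((r - a j : ℕ) : ZMod r)) = -(a j : ZMod r) := by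
    intro j
    rw [Nat.cast_sub (har j).le]
    simp
  simp_rw [hsub, neg_mul, ← sub_eq_add_neg]
  rcases Nat.eq_zero_or_pos m with rfl | hpos
  · simp
  refine sum_inv_prod_pairFactor_neg (ZMod.isPrimitive_stdAddChar r) ?_
    (pow_ne_zero _ (xi_ne_zero _)) ?_
  · intro i j hij
    by_contra hne
    have hdvd : (r : ℤ) ∣ ((a i : ℤ) - a j) * m := by
      rw [← ZMod.intCast_zmod_eq_zero_iff_dvd]
      push_cast
      rw [sub_mul, sub_eq_zero]
      exact hij
    have hcop : IsCoprime (r : ℤ) ((a i : ℤ) - a j) :=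
      (Int.isCoprime_iff_gcd_eq_one.2 (hgcd i j hne)).symm
    have hle := Nat.le_of_dvd hpos (Int.natCast_dvd_natCast.1 (hcop.dvd_of_dvd_mul_left hdvd))
    exact absurd (Finset.mem_range.1 hm) (not_lt.2 hle)
  · intro x
    have hv : (xi (r ^ 2) ^ m * ZMod.stdAddChar x) ^ (r ^ 2) = 1 := by
      rw [mul_pow, ← pow_mul, mul_comm m, pow_mul, xi_pow_self, one_pow, one_mul,
        ← AddChar.map_nsmul_eq_pow]
      simp
    refine mul_ne_zero (sub_ne_zero.2 ?_) (sub_ne_zero.2 ?_)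
    · rintro rfl
      exact hz hv
    · rintro rfl
      exact hw (by rw [inv_pow, hv, inv_one])

end
end

section
/- Let n ≥ 3 and let r > 3 be an odd integer; set k = r² and θ = r + 1. Let 0 ≤ a_1 < a_2 < … < a_n < r be integers with gcd(a_i − a_j, r) = 1 for all i ≠ j. Then the following are equivalent: (i) there exist a permutation σ of {1,…,n} and an integer c with gcd(c, r²) = 1 such that c·θ^{a_{σ(i)}} ≡ θ^{r−a_i} (mod r²) for every i (i.e., the CR lens spaces L⁺ and L⁻ are equivalent); (ii) there exists a permutation σ of {1,…,n} with σ∘σ = id and with at most one fixed point (equivalently, σ is a product of ⌊n/2⌋ disjoint transpositions) such that a_i + a_{σ(i)} ≡ a_j + a_{σ(j)} (mod r) for all i, j. -/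
/-- First-order binomial expansion: `(r + 1) ^ m ≡ 1 + m * r` modulo `r ^ 2`. -/
theorem sq_dvd_add_one_pow_sub (r : ℤ) (m : ℕ) : r ^ 2 ∣ (r + 1) ^ m - (1 + m * r) := by
  induction m with
  | zero => simp
  | succ m ih =>
    obtain ⟨t, ht⟩ := ih
    refine ⟨t * (r + 1) + m, ?_⟩
    push_cast
    rw [pow_succ]
    linear_combination (r + 1) * ht

/-- The congruence `(1 + s * r) * (r + 1) ^ b ≡ (r + 1) ^ (r - a)` modulo `r ^ 2` is
the congruence `a + b + s ≡ 0` modulo `r`. -/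
theorem sq_dvd_mul_pow_sub_pow_iff {r : ℕ} (hr : r ≠ 0) {a : ℕ} (ha : a ≤ r) (b : ℕ) (s : ℤ) :
    (r : ℤ) ^ 2 ∣ (1 + s * r) * ((r : ℤ) + 1) ^ b - ((r : ℤ) + 1) ^ (r - a) ↔
      (r : ℤ) ∣ a + b + s := by
  obtain ⟨u, hu⟩ := sq_dvd_add_one_pow_sub r b
  obtain ⟨v, hv⟩ := sq_dvd_add_one_pow_sub r (r - a)
  push_cast [ha] at hv
  have hr' : (r : ℤ) ≠ 0 := by exact_mod_cast hr
  have key : (1 + s * r) * ((r : ℤ) + 1) ^ b - ((r : ℤ) + 1) ^ (r - a) =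
      (r : ℤ) * (a + b + s) + (r : ℤ) ^ 2 * ((1 + s * r) * u - v + s * b - 1) := by
    linear_combination (1 + s * r) * hu - hv
  rw [key, dvd_add_left (dvd_mul_right _ _), sq, mul_dvd_mul_iff_left hr']

/-- If `c * (r + 1) ^ b ≡ (r + 1) ^ d` modulo `r ^ 2`, then `c ≡ 1` modulo `r`. -/
theorem dvd_sub_one_of_sq_dvd {r c : ℤ} {b d : ℕ}
    (h : r ^ 2 ∣ c * (r + 1) ^ b - (r + 1) ^ d) : r ∣ c - 1 := by
  obtain ⟨t, ht⟩ := h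
  obtain ⟨u, hu⟩ := sq_dvd_add_one_pow_sub r b
  obtain ⟨v, hv⟩ := sq_dvd_add_one_pow_sub r d
  refine ⟨r * t - c * (r * u + b) + r * v + d, ?_⟩
  linear_combination ht - c * hu + hv

/-- Natural numbers below `r` that are congruent modulo `r` are equal. -/
theorem eq_of_intCast_dvd_sub {r x y : ℕ} (hx : x < r) (hy : y < r)
    (h : (r : ℤ) ∣ (x : ℤ) - y) : x = y := by
  have := Int.eq_zero_of_abs_lt_dvd h (by rw [abs_lt]; omega)
  omega

/-- **Equivalence criterion for the pair `L⁺, L⁻` of the DeFord–Doyle type family.**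
With `r > 3` odd, `θ = r + 1`, and `0 ≤ a_1 < … < a_n < r` with `gcd(a_i - a_j, r) = 1`
for `i ≠ j`, the following are equivalent:
(i) there are a permutation `σ` and `c` coprime to `r²` with
`c·θ^{a_{σ(i)}} ≡ θ^{r-a_i} (mod r²)` for all `i` (i.e. `L⁺` and `L⁻` are equivalent);
(ii) there is an involutive permutation `σ` with at most one fixed point such that
`a_i + a_{σ(i)} ≡ a_j + a_{σ(j)} (mod r)` for all `i, j`. -/
theorem equivalence_criterion_for_pair (n r : ℕ) (hn : 3 ≤ n) (hr : 3 < r) (hodd : Odd r)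
    (a : Fin n → ℕ) (hmono : StrictMono a) (har : ∀ i, a i < r)
    (hgcd : ∀ i j, i ≠ j → Int.gcd ((a i : ℤ) - (a j : ℤ)) r = 1) :
    (∃ σ : Equiv.Perm (Fin n), ∃ c : ℤ, Int.gcd c (r ^ 2) = 1 ∧
        ∀ i, ((r : ℤ) ^ 2) ∣ (c * ((r : ℤ) + 1) ^ (a (σ i)) - ((r : ℤ) + 1) ^ (r - a i)))
      ↔ ∃ σ : Equiv.Perm (Fin n),
          σ * σ = 1 ∧ (∀ i j, σ i = i → σ j = j → i = j) ∧
          ∀ i j, (r : ℤ) ∣ (((a i : ℤ) + (a (σ i) : ℤ)) - ((a j : ℤ) + (a (σ j) : ℤ))) := by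
  have inj : ∀ i j, (r : ℤ) ∣ (a i : ℤ) - a j → i = j := fun i j h =>
    hmono.injective (eq_of_intCast_dvd_sub (har i) (har j) h)
  have i₀ : Fin n := ⟨0, by omega⟩
  constructor
  · rintro ⟨σ, c, -, hc⟩
    obtain ⟨s, hs⟩ := dvd_sub_one_of_sq_dvd (hc i₀)
    obtain rfl : c = 1 + s * r := by linear_combination hs
    have hsum : ∀ i, (r : ℤ) ∣ a i + a (σ i) + s := fun i =>
      (sq_dvd_mul_pow_sub_pow_iff (by omega) (har i).le _ s).1 (hc i)
    refine ⟨σ, ?_, fun i j hi hj => ?_, fun i j => ?_⟩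
    · ext1 i
      refine inj _ _ ?_
      have h := dvd_sub (hsum (σ i)) (hsum i)
      rwa [add_sub_add_right_eq_sub, add_comm (a i : ℤ), add_sub_add_left_eq_sub] at h
    · have hi' := hsum i
      have hj' := hsum j
      rw [hi] at hi'
      rw [hj] at hj'
      have hcop : IsCoprime (r : ℤ) 2 := by
        exact_mod_cast Nat.isCoprime_iff_coprime.2 hodd.coprime_two_right
      refine inj _ _ (hcop.dvd_of_dvd_mul_left ?_)
      convert dvd_sub hi' hj' using 1
      ring
    · simpa only [add_sub_add_right_eq_sub] using dvd_sub (hsum i) (hsum j)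
  · rintro ⟨σ, -, -, hσ⟩
    refine ⟨σ, 1 + -(a i₀ + a (σ i₀)) * r, ?_, fun i => ?_⟩
    · rw [← Int.isCoprime_iff_gcd_eq_one]
      exact IsCoprime.pow_right ⟨1, a i₀ + a (σ i₀), by ring⟩
    · rw [sq_dvd_mul_pow_sub_pow_iff (by omega) (har i).le, ← sub_eq_add_neg]
      exact hσ i i₀
end
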